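/- arXiv:1204.3613 — 3 statements merged into one kernel-verified Lean document; each statement's English description precedes it below -/
import Mathlib

section
/- Let q : ℝ → ℂ be 1-periodic, integrable on [0,1], with Fourier coefficients q_n = ∫₀¹ q(x)e^{-2πinx}dx satisfying q_n = 0 for all integers n ≤ 0. Then for every t ∈ ℂ, every eigenvalue λ of the boundary value problem L_t(q) equals (2πn+t)² for some integer n; that is, if there exists a not-identically-zero function y : ℝ → ℂ, differentiable with y'(x) = y'(0) + ∫₀ˣ (q(s) − λ)y(s)ds for all x, satisfying y(1) = e^{it}y(0) and y'(1) = e^{it}y'(0), then λ = (2πn+t)² for some n ∈ ℤ. -/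
open MeasureTheory Filter

noncomputable section

/-- The `n`-th Fourier coefficient of `q` on `[0,1]`: `∫₀¹ q(x) e^{-2πinx} dx`. -/
def fCoeff (q : ℝ → ℂ) (n : ℤ) : ℂ :=
  ∫ x in (0:ℝ)..1, q x * Complex.exp (-(2 * (Real.pi : ℂ) * Complex.I * (n : ℂ) * (x : ℂ)))

/-- `q` is 1-periodic, integrable on `[0,1]`, and all its Fourier coefficients with
nonpositive index vanish (the class `L¹₊`). -/
def MemL1Plus (q : ℝ → ℂ) : Prop :=
  (∀ x : ℝ, q (x + 1) = q x) ∧ IntervalIntegrable q volume 0 1 ∧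
    ∀ n : ℤ, n ≤ 0 → fCoeff q n = 0

/-- `y` is a solution of `-y'' + q y = lam y` in the integral (Carathéodory) sense. -/
def IsCaraSol (q : ℝ → ℂ) (lam : ℂ) (y : ℝ → ℂ) : Prop :=
  Differentiable ℝ y ∧
    ∀ x : ℝ, deriv y x = deriv y 0 + ∫ s in (0:ℝ)..x, (q s - lam) * y s

/-- `y` is an eigenfunction of `L_t(q)` with eigenvalue `lam`. -/
def IsEigenfun (q : ℝ → ℂ) (t lam : ℂ) (y : ℝ → ℂ) : Prop :=
  IsCaraSol q lam y ∧ (∃ x : ℝ, y x ≠ 0) ∧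
    y 1 = Complex.exp (Complex.I * t) * y 0 ∧
    deriv y 1 = Complex.exp (Complex.I * t) * deriv y 0

/-- Integration by parts against the primitive of a merely integrable function. -/
theorem integral_mul_eq_sub_integral_primitive_mul {g φ φ' : ℝ → ℂ}
    (hg : IntervalIntegrable g volume 0 1) (hφ : ∀ x, HasDerivAt φ (φ' x) x)
    (hφ' : Continuous φ') :
    ∫ x in (0:ℝ)..1, g x * φ x =
      (∫ x in (0:ℝ)..1, g x) * φ 1 - ∫ x in (0:ℝ)..1, (∫ s in (0:ℝ)..x, g s) * φ' x := by
  have hcφ : Continuous φ := continuous_iff_continuousAt.2 fun x => (hφ x).continuousAt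
  have hg' : Integrable g (volume.restrict (Set.Ioc (0:ℝ) 1)) :=
    (intervalIntegrable_iff_integrableOn_Ioc_of_le zero_le_one).1 hg
  have hφi : Integrable φ' (volume.restrict (Set.Ioc (0:ℝ) 1)) :=
    (intervalIntegrable_iff_integrableOn_Ioc_of_le zero_le_one).1 (hφ'.intervalIntegrable 0 1)
  have key : ∫ x in (0:ℝ)..1, (∫ s in (0:ℝ)..x, g s) * φ' x =
      ∫ s in (0:ℝ)..1, g s * (φ 1 - φ s) := by
    rw [intervalIntegral.integral_of_le zero_le_one, intervalIntegral.integral_of_le zero_le_one]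
    have hsw := integral_integral_swap (μ := volume.restrict (Set.Ioc (0:ℝ) 1))
      (ν := volume.restrict (Set.Ioc (0:ℝ) 1))
      (f := fun x s => {p : ℝ × ℝ | p.2 ≤ p.1}.indicator (fun p => φ' p.1 * g p.2) (x, s))
      ((hφi.mul_prod hg').indicator (measurableSet_le measurable_snd measurable_fst))
    have hl : ∀ x ∈ Set.Ioc (0:ℝ) 1, (∫ s in (0:ℝ)..x, g s) * φ' x =
        ∫ s in Set.Ioc (0:ℝ) 1,
          {p : ℝ × ℝ | p.2 ≤ p.1}.indicator (fun p => φ' p.1 * g p.2) (x, s) := by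
      intro x hx
      have h1 : (fun s => {p : ℝ × ℝ | p.2 ≤ p.1}.indicator (fun p => φ' p.1 * g p.2) (x, s)) =
          (Set.Iic x).indicator (fun s => φ' x * g s) := by
        ext s; simp [Set.indicator]
      rw [h1, setIntegral_indicator measurableSet_Iic, intervalIntegral.integral_of_le hx.1.le,
        integral_const_mul, mul_comm]
      congr 3
      ext s; simp only [Set.mem_Ioc, Set.mem_inter_iff, Set.mem_Iic]
      grind
    have hr : ∀ s ∈ Set.Ioc (0:ℝ) 1, g s * (φ 1 - φ s) =
        ∫ x in Set.Ioc (0:ℝ) 1,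
          {p : ℝ × ℝ | p.2 ≤ p.1}.indicator (fun p => φ' p.1 * g p.2) (x, s) := by
      intro s hs
      have h1 : (fun x => {p : ℝ × ℝ | p.2 ≤ p.1}.indicator (fun p => φ' p.1 * g p.2) (x, s)) =
          (Set.Ici s).indicator (fun x => φ' x * g s) := by
        ext x; simp [Set.indicator]
      rw [h1, setIntegral_indicator measurableSet_Ici, integral_mul_const,
        ← intervalIntegral.integral_eq_sub_of_hasDerivAt (fun x _ => hφ x)
          (hφ'.intervalIntegrable s 1), intervalIntegral.integral_of_le hs.2,
        ← integral_Icc_eq_integral_Ioc, mul_comm]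
      congr 3
      ext x; simp only [Set.mem_Ioc, Set.mem_Icc, Set.mem_inter_iff, Set.mem_Ici]
      grind
    rw [setIntegral_congr_fun measurableSet_Ioc hl, setIntegral_congr_fun measurableSet_Ioc hr]
    exact hsw
  rw [key, ← intervalIntegral.integral_mul_const, ← intervalIntegral.integral_sub
    (hg.mul_const _) (hg.mul_continuousOn (by fun_prop))]
  congr 1; ext x; ring

/-- A Carathéodory solution with zero Cauchy data at `a` vanishes near `a`. -/
theorem IsCaraSol.eventually_eq_zero {q : ℝ → ℂ} {lam : ℂ} {y : ℝ → ℂ} (hy : IsCaraSol q lam y)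
    (hq : ∀ a b, IntervalIntegrable q volume a b) {a : ℝ} (h0 : y a = 0) (h1 : deriv y a = 0) :
    ∀ᶠ x in nhds a, y x = 0 := by
  have hcy := hy.1.continuous
  have hp : ∀ a b, IntervalIntegrable (fun s => q s - lam) volume a b :=
    fun a b => (hq a b).sub intervalIntegrable_const
  set K := ∫ s in (a - 1)..(a + 1), ‖q s - lam‖ with hK
  have hK0 : 0 ≤ K := intervalIntegral.integral_nonneg (by linarith) fun _ _ => norm_nonneg _
  set δ := 1 / (K + 2) with hδ
  have hδ0 : 0 < δ := by positivity
  have hδ1 : δ ≤ 1 := by rw [hδ, div_le_one (by positivity)]; linarith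
  have hKδ : K * δ < 1 := by
    rw [hδ, mul_one_div, div_lt_one (by positivity)]; linarith
  have haJ : a ∈ Set.Icc (a - δ) (a + δ) := ⟨by linarith, by linarith⟩
  obtain ⟨z, hz, hmax⟩ := isCompact_Icc.exists_isMaxOn ⟨a, haJ⟩ (hcy.norm.continuousOn)
  have hd : ∀ x ∈ Set.Icc (a - δ) (a + δ), ‖deriv y x‖ ≤ ‖y z‖ * K := by
    intro x hx
    have hsub : Set.uIoc a x ⊆ Set.Icc (a - δ) (a + δ) :=
      Set.uIoc_subset_uIcc.trans (Set.uIcc_subset_Icc haJ hx)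
    have hpy : ∀ a b, IntervalIntegrable (fun s => (q s - lam) * y s) volume a b :=
      fun a b => (hp a b).mul_continuousOn hcy.continuousOn
    have e : deriv y x = ∫ s in a..x, (q s - lam) * y s := by
      have e1 := hy.2 x
      have e2 := hy.2 a
      rw [h1] at e2
      rw [← intervalIntegral.integral_add_adjacent_intervals (hpy 0 a) (hpy a x)] at e1
      rw [e1]; linear_combination e2.symm
    rw [e, intervalIntegral.norm_intervalIntegral_eq]
    calc ‖∫ s in Set.uIoc a x, (q s - lam) * y s‖
        ≤ ∫ s in Set.uIoc a x, ‖y z‖ * ‖q s - lam‖ := by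
          refine norm_integral_le_of_norm_le ((hp a x).def'.norm.const_mul _) ?_
          refine (ae_restrict_mem measurableSet_uIoc).mono fun s hs => ?_
          rw [norm_mul, mul_comm]
          exact mul_le_mul_of_nonneg_right (hmax (hsub hs)) (norm_nonneg _)
      _ ≤ ‖y z‖ * K := by
          rw [integral_const_mul, hK, intervalIntegral.integral_of_le (by linarith)]
          refine mul_le_mul_of_nonneg_left ?_ (norm_nonneg _)
          refine setIntegral_mono_set (hp (a - 1) (a + 1)).norm.1
            (Eventually.of_forall fun _ => norm_nonneg _) (LE.le.eventuallyLE ?_)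
          intro s hs
          have := Set.mem_Icc.1 hx
          simp only [Set.mem_uIoc, Set.mem_Ioc] at hs ⊢
          grind
  have hyz : ‖y z‖ ≤ ‖y z‖ * K * δ := by
    have h := (convex_Icc (a - δ) (a + δ)).norm_image_sub_le_of_norm_deriv_le
      (fun x _ => hy.1 x) hd haJ hz
    rw [h0, sub_zero] at h
    refine h.trans (mul_le_mul_of_nonneg_left ?_ (by positivity))
    rw [Real.norm_eq_abs, abs_le]
    constructor <;> linarith [hz.1, hz.2]
  have hyz0 : ‖y z‖ = 0 := by nlinarith [norm_nonneg (y z)]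
  filter_upwards [Icc_mem_nhds (by linarith : a - δ < a) (by linarith : a < a + δ)] with x hx
  have : ‖y x‖ ≤ ‖y z‖ := hmax hx
  exact norm_le_zero_iff.1 (this.trans hyz0.le)

/-- A Carathéodory solution with zero Cauchy data at one point vanishes identically. -/
theorem IsCaraSol.eq_zero {q : ℝ → ℂ} {lam : ℂ} {y : ℝ → ℂ} (hy : IsCaraSol q lam y)
    (hq : ∀ a b, IntervalIntegrable q volume a b) {a : ℝ} (h0 : y a = 0) (h1 : deriv y a = 0) :
    ∀ x, y x = 0 := by
  have hcy := hy.1.continuous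
  have hcd : Continuous (deriv y) := by
    rw [show deriv y = fun x => deriv y 0 + ∫ s in (0:ℝ)..x, (q s - lam) * y s from funext hy.2]
    exact continuous_const.add (intervalIntegral.continuous_primitive
      (fun a b => ((hq a b).sub intervalIntegrable_const).mul_continuousOn hcy.continuousOn) 0)
  have hclopen : IsClopen {x | y x = 0 ∧ deriv y x = 0} := by
    refine ⟨(isClosed_eq hcy continuous_const).inter (isClosed_eq hcd continuous_const),
      isOpen_iff_eventually.2 fun x hx => ?_⟩
    have h := hy.eventually_eq_zero hq hx.1 hx.2
    filter_upwards [h, h.eventually_nhds] with z hz hz'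
    refine ⟨hz, ?_⟩
    have : y =ᶠ[nhds z] fun _ => 0 := hz'
    rw [this.deriv_eq, deriv_const]
  have huniv := hclopen.eq_univ ⟨a, h0, h1⟩
  intro x
  have : x ∈ {x | y x = 0 ∧ deriv y x = 0} := huniv ▸ Set.mem_univ x
  exact this.1

/-- The monomial `fourier (-n)` on the circle of length one, written as an exponential. -/
theorem fourier_neg_coe_unit (n : ℤ) (x : ℝ) :
    fourier (-n) (x : AddCircle (1:ℝ)) =
      Complex.exp (-(2 * (Real.pi : ℂ) * Complex.I * (n : ℂ) * (x : ℂ))) := by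
  rw [fourier_coe_apply]
  congr 1; push_cast; ring

/-- `fCoeff` is the Fourier coefficient of the function lifted to the circle. -/
theorem fourierCoeff_liftIco_eq_fCoeff (u : ℝ → ℂ) (n : ℤ) :
    fourierCoeff (AddCircle.liftIco (1:ℝ) 0 u) n = fCoeff u n := by
  rw [fourierCoeff_eq_intervalIntegral _ _ 0, fCoeff, zero_add, one_div_one, one_smul]
  refine intervalIntegral.integral_congr_Ioo_of_le zero_le_one fun x hx => ?_
  rw [AddCircle.liftIco_zero_coe_apply (Set.Ioo_subset_Ico_self hx), fourier_neg_coe_unit,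
    smul_eq_mul, mul_comm]

/-- Pointwise Fourier expansion on `[0,1)` of a function with summable coefficients. -/
theorem hasSum_fCoeff_mul_exp {u : ℝ → ℂ} (hu : Continuous u) (hu01 : u 0 = u 1)
    (hs : Summable (fCoeff u)) {x : ℝ} (hx : x ∈ Set.Ico (0:ℝ) 1) :
    HasSum (fun k : ℤ => fCoeff u k *
      Complex.exp (-(2 * (Real.pi : ℂ) * Complex.I * ((-k : ℤ) : ℂ) * (x : ℂ)))) (u x) := by
  let f : C(AddCircle (1:ℝ), ℂ) :=
    ⟨AddCircle.liftIco 1 0 u, AddCircle.liftIco_zero_continuous hu01 hu.continuousOn⟩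
  have hf : fourierCoeff f = fCoeff u := funext fun n => fourierCoeff_liftIco_eq_fCoeff u n
  have h := has_pointwise_sum_fourier_series_of_summable (f := f) (hf ▸ hs) (x : AddCircle (1:ℝ))
  have hfx : f (x : AddCircle (1:ℝ)) = u x := AddCircle.liftIco_zero_coe_apply hx
  rw [hfx, hf] at h
  convert! h using 2 with k
  rw [← fourier_neg_coe_unit, neg_neg, smul_eq_mul]

/-- The exponentials in `fCoeff` have norm one. -/
theorem norm_exp_fourier (n : ℤ) (x : ℝ) :
    ‖Complex.exp (-(2 * (Real.pi : ℂ) * Complex.I * (n : ℂ) * (x : ℂ)))‖ = 1 := by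
  rw [Complex.norm_exp]
  simp

/-- Fourier coefficients are bounded by the `L¹` norm. -/
theorem norm_fCoeff_le (q : ℝ → ℂ) (n : ℤ) : ‖fCoeff q n‖ ≤ ∫ x in (0:ℝ)..1, ‖q x‖ := by
  refine (intervalIntegral.norm_integral_le_integral_norm zero_le_one).trans_eq ?_
  simp only [norm_mul, norm_exp_fourier, mul_one]

/-- The Fourier coefficients of a product are the convolution of the coefficients. -/
theorem hasSum_fCoeff_mul {q u : ℝ → ℂ} (hq : IntervalIntegrable q volume 0 1)
    (hu : Continuous u) (hu01 : u 0 = u 1) (hs : Summable (fCoeff u)) (n : ℤ) :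
    HasSum (fun k : ℤ => fCoeff u k * fCoeff q (n - k)) (fCoeff (fun x => q x * u x) n) := by
  have hcont : ∀ m : ℤ, Continuous fun x : ℝ =>
      Complex.exp (-(2 * (Real.pi : ℂ) * Complex.I * (m : ℂ) * (x : ℂ))) := fun m => by fun_prop
  have h := intervalIntegral.hasSum_integral_of_dominated_convergence (μ := volume)
    (a := (0:ℝ)) (b := 1)
    (F := fun (k : ℤ) x => fCoeff u k *
      (q x * Complex.exp (-(2 * (Real.pi : ℂ) * Complex.I * ((n - k : ℤ) : ℂ) * (x : ℂ)))))
    (f := fun x => q x * u x *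
      Complex.exp (-(2 * (Real.pi : ℂ) * Complex.I * (n : ℂ) * (x : ℂ))))
    (fun k x => ‖fCoeff u k‖ * ‖q x‖)
    (fun k => ((hq.mul_continuousOn (hcont _).continuousOn).const_mul _).def'.1)
    (fun k => Eventually.of_forall fun x _ => by
      rw [norm_mul, norm_mul, norm_exp_fourier, mul_one])
    (Eventually.of_forall fun x _ => hs.norm.mul_right _)
    (by simp only [tsum_mul_right]; exact hq.norm.const_mul _)
    (by
      filter_upwards [Measure.ae_ne volume (1:ℝ)] with x hx1 hx
      rw [Set.uIoc_of_le zero_le_one] at hx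
      have hsum := (hasSum_fCoeff_mul_exp hu hu01 hs
        ⟨hx.1.le, lt_of_le_of_ne hx.2 hx1⟩).mul_left
        (q x * Complex.exp (-(2 * (Real.pi : ℂ) * Complex.I * (n : ℂ) * (x : ℂ))))
      convert! hsum using 1
      · ext k
        rw [mul_mul_mul_comm, ← Complex.exp_add, mul_comm (q x) (fCoeff u k),
          mul_assoc (fCoeff u k)]
        congr 3
        push_cast; ring
      · ring)
  simp only [intervalIntegral.integral_const_mul] at h
  exact h

/-- A summable solution of a strictly lower triangular recursion whose diagonal has summable
inverse is zero. -/
theorem eq_zero_of_hasSum_triangular {a c d : ℤ → ℂ} {K : ℝ} (ha : Summable a)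
    (hc0 : ∀ n ≤ 0, c n = 0) (hcK : ∀ n, ‖c n‖ ≤ K) (hd : ∀ n, d n ≠ 0)
    (hds : Summable fun n => (d n)⁻¹)
    (h : ∀ n, HasSum (fun k => a k * c (n - k)) (d n * a n)) : ∀ n, a n = 0 := by
  have hK : 0 ≤ K := (norm_nonneg _).trans (hcK 0)
  obtain ⟨s, hs⟩ := summable_iff_vanishing_norm.1 hds.norm (1 / (2 * (K + 1))) (by positivity)
  obtain ⟨N, hN⟩ := s.bddBelow
  have hsumN : ∀ N, Summable ((Set.Iio N).indicator fun k => ‖a k‖) := fun N =>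
    ha.norm.indicator _
  set M := ∑' k, (Set.Iio N).indicator (fun k => ‖a k‖) k with hM
  have hM0 : 0 ≤ M := tsum_nonneg fun k => Set.indicator_nonneg (fun _ _ => norm_nonneg _) k
  have hbound : ∀ n < N, ‖a n‖ ≤ K * M * ‖(d n)⁻¹‖ := by
    intro n hn
    have hle : ‖d n * a n‖ ≤ M * K := by
      rw [← (h n).tsum_eq]
      refine tsum_of_norm_bounded ((hsumN N).hasSum.mul_right K) fun k => ?_
      by_cases hk : k < n
      · rw [Set.indicator_of_mem (Set.mem_Iio.2 (hk.trans hn)), norm_mul]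
        exact mul_le_mul_of_nonneg_left (hcK _) (norm_nonneg _)
      · rw [hc0 _ (by lia), mul_zero, norm_zero]
        exact mul_nonneg (Set.indicator_nonneg (fun _ _ => norm_nonneg _) k) hK
    calc ‖a n‖ = ‖d n * a n‖ * ‖(d n)⁻¹‖ := by
          rw [← norm_mul, mul_right_comm, mul_inv_cancel₀ (hd n), one_mul]
      _ ≤ M * K * ‖(d n)⁻¹‖ := mul_le_mul_of_nonneg_right hle (norm_nonneg _)
      _ = _ := by ring
  have hMle : M ≤ M / 2 := by
    refine (hsumN N).tsum_le_of_sum_le fun t => ?_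
    rw [Finset.sum_indicator_eq_sum_filter]
    have hdis : Disjoint (t.filter (· ∈ Set.Iio N)) s := by
      rw [Finset.disjoint_left]
      intro k hk hks
      exact absurd (hN hks) (not_le.2 (Finset.mem_filter.1 hk).2)
    have h1 := ((Real.le_norm_self _).trans_lt (hs _ hdis)).le
    calc ∑ k ∈ t with k ∈ Set.Iio N, ‖a k‖
        ≤ ∑ k ∈ t with k ∈ Set.Iio N, K * M * ‖(d k)⁻¹‖ :=
          Finset.sum_le_sum fun k hk => hbound k (Finset.mem_filter.1 hk).2
      _ ≤ K * M * (1 / (2 * (K + 1))) := by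
          rw [← Finset.mul_sum]
          exact mul_le_mul_of_nonneg_left h1 (by positivity)
      _ = M / 2 * (K / (K + 1)) := by field_simp
      _ ≤ M / 2 := mul_le_of_le_one_right (by positivity)
          ((div_le_one (by positivity)).2 (by linarith))
  have hMz : M = 0 := by linarith
  have hbase : ∀ k < N, a k = 0 := fun k hk => by
    have := hbound k hk
    rw [hMz, mul_zero, zero_mul] at this
    exact norm_le_zero_iff.1 this
  have hind : ∀ m : ℕ, ∀ k < N + m, a k = 0 := by
    intro m
    induction m with
    | zero => simpa using hbase
    | succ m ih =>
      intro k hk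
      by_cases hkm : k < N + m
      · exact ih k hkm
      have hz : (fun j => a j * c (k - j)) = fun _ => 0 := by
        ext j
        by_cases hj : j < k
        · rw [ih j (by push_cast at hk; lia), zero_mul]
        · rw [hc0 _ (by lia), mul_zero]
      have hk' := h k
      rw [hz] at hk'
      exact (mul_eq_zero.1 (hk'.unique hasSum_zero)).resolve_left (hd k)
  intro n
  exact hind (n - N + 1).toNat n (by lia)

/-- The inverses of `lam - (2πn + t)²` are summable over `n ∈ ℤ`. -/
theorem summable_inv_sub_sq (t lam : ℂ) :
    Summable fun n : ℤ => (lam - (2 * (Real.pi : ℂ) * (n : ℂ) + t) ^ 2)⁻¹ := by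
  refine Summable.of_norm_bounded_eventually (g := fun n : ℤ => 1 / (n : ℝ) ^ 2)
    (Real.summable_one_div_int_pow.2 one_lt_two) ?_
  have hev : ∀ᶠ n : ℤ in cofinite, ‖t‖ + ‖lam‖ + 1 ≤ |(n : ℝ)| := by
    have := (tendsto_norm_cocompact_atTop (E := ℝ)).comp Int.tendsto_coe_cofinite
    exact this.eventually_ge_atTop _
  filter_upwards [hev] with n hn
  have ht := norm_nonneg t
  have hl := norm_nonneg lam
  have h1 : 5 * |(n : ℝ)| ≤ ‖2 * (Real.pi : ℂ) * (n : ℂ) + t‖ := by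
    have h := norm_sub_le_norm_add (2 * (Real.pi : ℂ) * (n : ℂ)) t
    have h2 : ‖2 * (Real.pi : ℂ) * (n : ℂ)‖ = 2 * Real.pi * |(n : ℝ)| := by
      simp [abs_of_pos Real.pi_pos]
    rw [h2] at h
    nlinarith [Real.pi_gt_three]
  have h3 : (n : ℝ) ^ 2 ≤ ‖lam - (2 * (Real.pi : ℂ) * (n : ℂ) + t) ^ 2‖ := by
    have h := norm_sub_norm_le ((2 * (Real.pi : ℂ) * (n : ℂ) + t) ^ 2) lam
    rw [norm_sub_rev, norm_pow] at h
    rw [← sq_abs]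
    nlinarith [abs_nonneg (n : ℝ)]
  rw [norm_inv, ← one_div]
  refine one_div_le_one_div_of_le ?_ h3
  rw [← sq_abs]
  exact pow_pos (by linarith) 2

/-- Pairing a Carathéodory solution satisfying the quasi-periodic boundary conditions with
`exp (-iωx)`, where `exp (iω) = exp (it)`. -/
theorem IsCaraSol.integral_mul_exp {q : ℝ → ℂ} {lam : ℂ} {y : ℝ → ℂ} (hy : IsCaraSol q lam y)
    (hq : ∀ a b, IntervalIntegrable q volume a b) {ω : ℂ}
    (hb : y 1 = Complex.exp (Complex.I * ω) * y 0)
    (hb' : deriv y 1 = Complex.exp (Complex.I * ω) * deriv y 0) :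
    ∫ x in (0:ℝ)..1, q x * y x * Complex.exp (-(Complex.I * ω) * x) =
      (lam - ω ^ 2) * ∫ x in (0:ℝ)..1, y x * Complex.exp (-(Complex.I * ω) * x) := by
  have hcy := hy.1.continuous
  have hg : ∀ a b, IntervalIntegrable (fun s => (q s - lam) * y s) volume a b := fun a b =>
    ((hq a b).sub intervalIntegrable_const).mul_continuousOn hcy.continuousOn
  have hcd : Continuous (deriv y) := by
    rw [show deriv y = fun x => deriv y 0 + ∫ s in (0:ℝ)..x, (q s - lam) * y s from funext hy.2]
    exact continuous_const.add (intervalIntegral.continuous_primitive hg 0)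
  set κ := -(Complex.I * ω) with hκ
  have hE : ∀ x : ℝ, HasDerivAt (fun x : ℝ => Complex.exp (κ * x)) (κ * Complex.exp (κ * x)) x := by
    intro x
    have h := (((hasDerivAt_id (x : ℂ)).const_mul κ).cexp).comp_ofReal
    simpa [mul_comm] using h
  have hcE : Continuous fun x : ℝ => Complex.exp (κ * x) := by fun_prop
  have hcE' : Continuous fun x : ℝ => κ * Complex.exp (κ * x) := by fun_prop
  have hcdE : Continuous fun x : ℝ => deriv y x * Complex.exp (κ * x) := hcd.mul hcE
  have hcyE : Continuous fun x : ℝ => y x * Complex.exp (κ * x) := hcy.mul hcE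
  have hcdE' : Continuous fun x : ℝ => deriv y x * (κ * Complex.exp (κ * x)) := hcd.mul hcE'
  have hcyE' : Continuous fun x : ℝ => y x * (κ * Complex.exp (κ * x)) := hcy.mul hcE'
  have hE1 : Complex.exp (Complex.I * ω) * Complex.exp κ = 1 := by
    rw [← Complex.exp_add, hκ, add_neg_cancel, Complex.exp_zero]
  have i1 := integral_mul_eq_sub_integral_primitive_mul (hg 0 1) hE hcE'
  have e1 : ∫ x in (0:ℝ)..1, (∫ s in (0:ℝ)..x, (q s - lam) * y s) * (κ * Complex.exp (κ * x)) =
      (∫ x in (0:ℝ)..1, deriv y x * (κ * Complex.exp (κ * x))) -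
        deriv y 0 * (Complex.exp κ - 1) := by
    have : Complex.exp κ - 1 = ∫ x in (0:ℝ)..1, κ * Complex.exp (κ * x) := by
      rw [intervalIntegral.integral_eq_sub_of_hasDerivAt (fun x _ => hE x)
        (hcE'.intervalIntegrable 0 1)]
      simp
    rw [this, ← intervalIntegral.integral_const_mul, ← intervalIntegral.integral_sub
      (hcdE'.intervalIntegrable 0 1) ((hcE'.intervalIntegrable 0 1).const_mul _)]
    refine intervalIntegral.integral_congr fun x _ => ?_
    simp only [hy.2 x]; ring
  have i2 := intervalIntegral.integral_deriv_mul_eq_sub (a := 0) (b := 1)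
    (fun x _ => (hy.1 x).hasDerivAt) (fun x _ => hE x)
    (hcd.intervalIntegrable 0 1) (hcE'.intervalIntegrable 0 1)
  rw [intervalIntegral.integral_add (hcdE.intervalIntegrable 0 1)
    (hcyE'.intervalIntegrable 0 1)] at i2
  have c1 : ∀ f : ℝ → ℂ, ∫ x in (0:ℝ)..1, f x * (κ * Complex.exp (κ * x)) =
      κ * ∫ x in (0:ℝ)..1, f x * Complex.exp (κ * x) := fun f => by
    rw [← intervalIntegral.integral_const_mul]
    congr 1; ext x; ring
  have s1 : ∫ x in (0:ℝ)..1, (q x - lam) * y x * Complex.exp (κ * x) =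
      (∫ x in (0:ℝ)..1, q x * y x * Complex.exp (κ * x)) -
        lam * ∫ x in (0:ℝ)..1, y x * Complex.exp (κ * x) := by
    rw [← intervalIntegral.integral_const_mul, ← intervalIntegral.integral_sub
      (((hq 0 1).mul_continuousOn hcy.continuousOn).mul_continuousOn hcE.continuousOn)
      ((hcyE.intervalIntegrable 0 1).const_mul _)]
    congr 1; ext x; ring
  have d1 := hy.2 1
  rw [e1, s1, c1] at i1
  rw [c1] at i2
  simp only [Complex.ofReal_one, Complex.ofReal_zero, mul_one, mul_zero, Complex.exp_zero] at i1 i2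
  have hκ2 : κ ^ 2 = -ω ^ 2 := by rw [hκ]; linear_combination ω ^ 2 * Complex.I_sq
  rw [hb] at i2
  rw [hb'] at d1
  linear_combination i1 - κ * i2 - Complex.exp κ * d1 + (deriv y 0 - κ * y 0) * hE1 +
    (∫ x in (0:ℝ)..1, y x * Complex.exp (κ * x)) * hκ2

/-- Every eigenvalue of `L_t(q)` for `q ∈ L¹₊` equals `(2πn + t)²` for some `n ∈ ℤ`. -/
theorem every_eigenvalue_eq (q : ℝ → ℂ) (hq : MemL1Plus q) (t lam : ℂ)
    (y : ℝ → ℂ) (hy : IsEigenfun q t lam y) :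
    ∃ n : ℤ, lam = (2 * (Real.pi : ℂ) * (n : ℂ) + t) ^ 2 := by
  obtain ⟨hper, hq01, hq0⟩ := hq
  obtain ⟨hsol, ⟨x₀, hx₀⟩, hb, hb'⟩ := hy
  have hqi : ∀ a b, IntervalIntegrable q volume a b :=
    Function.Periodic.intervalIntegrable₀ (T := 1) hper one_ne_zero hq01
  by_contra! hne
  set u : ℝ → ℂ := fun x => y x * Complex.exp (-(Complex.I * t) * x) with hu
  have hcu : Continuous u := hsol.1.continuous.mul (by fun_prop)
  have hu01 : u 0 = u 1 := by
    simp only [hu, hb, Complex.ofReal_zero, mul_zero, Complex.exp_zero, Complex.ofReal_one, mul_one]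
    rw [mul_right_comm, ← Complex.exp_add, add_neg_cancel, Complex.exp_zero, one_mul]
  have hd : ∀ n : ℤ, lam - (2 * (Real.pi : ℂ) * (n : ℂ) + t) ^ 2 ≠ 0 :=
    fun n => sub_ne_zero.2 (hne n)
  have hexp : ∀ (n : ℤ) (x : ℝ), Complex.exp (-(Complex.I * t) * x) *
      Complex.exp (-(2 * (Real.pi : ℂ) * Complex.I * (n : ℂ) * (x : ℂ))) =
      Complex.exp (-(Complex.I * (2 * (Real.pi : ℂ) * (n : ℂ) + t)) * x) := fun n x => by
    rw [← Complex.exp_add]; congr 1; ring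
  have hrel : ∀ n : ℤ, fCoeff (fun x => q x * u x) n =
      (lam - (2 * (Real.pi : ℂ) * (n : ℂ) + t) ^ 2) * fCoeff u n := by
    intro n
    have he : Complex.exp (Complex.I * (2 * (Real.pi : ℂ) * (n : ℂ) + t)) =
        Complex.exp (Complex.I * t) := by
      rw [← Complex.exp_periodic.int_mul n (Complex.I * t)]
      congr 1; ring
    have h := hsol.integral_mul_exp hqi (ω := 2 * (Real.pi : ℂ) * (n : ℂ) + t)
      (by rw [he, hb]) (by rw [he, hb'])
    simp only [fCoeff, hu]
    simpa only [mul_assoc (y _), mul_assoc (q _), hexp] using h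
  have hds := summable_inv_sub_sq t lam
  have hs : Summable (fCoeff u) := by
    refine Summable.of_norm_bounded (hds.norm.mul_left (∫ x in (0:ℝ)..1, ‖q x * u x‖)) fun n => ?_
    have h := norm_fCoeff_le (fun x => q x * u x) n
    rw [hrel n, norm_mul] at h
    rw [norm_inv, ← div_eq_mul_inv, le_div_iff₀ (norm_pos_iff.2 (hd n)), mul_comm]
    exact h
  have hz := eq_zero_of_hasSum_triangular hs hq0 (norm_fCoeff_le q) hd hds
    fun n => hrel n ▸ hasSum_fCoeff_mul hq01 hcu hu01 hs n
  have hy0 : ∀ x ∈ Set.Ico (0:ℝ) 1, y x = 0 := by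
    intro x hx
    have h := hasSum_fCoeff_mul_exp hcu hu01 hs hx
    simp only [hz, zero_mul] at h
    exact (mul_eq_zero.1 (h.unique hasSum_zero)).resolve_right (Complex.exp_ne_zero _)
  have hd0 : deriv y (1 / 2) = 0 := by
    have : y =ᶠ[nhds (1 / 2)] fun _ => 0 := by
      filter_upwards [Ico_mem_nhds (by norm_num : (0:ℝ) < 1 / 2) (by norm_num : (1 / 2 : ℝ) < 1)]
        with x hx using hy0 x hx
    rw [this.deriv_eq, deriv_const]
  exact hx₀ (hsol.eq_zero hqi (hy0 (1 / 2) (by norm_num)) hd0 x₀)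

end
end

section
/- Let q : ℝ → ℂ be 1-periodic, integrable on [0,1], with Fourier coefficients q_n = ∫₀¹ q(x)e^{-2πinx}dx satisfying q_n = 0 for all integers n ≤ 0. Then for every t ∈ ℂ and every integer n, the number (2πn+t)² is an eigenvalue of L_t(q): there exists a not-identically-zero function y : ℝ → ℂ, differentiable with y'(x) = y'(0) + ∫₀ˣ (q(s) − (2πn+t)²)y(s)ds for all x, satisfying y(1) = e^{it}y(0) and y'(1) = e^{it}y'(0). -/
open MeasureTheory Filter

noncomputable section

section PrimitiveProduct

open Set

lemma absolutelyContinuousOnInterval_primitive {r : ℝ → ℂ}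
    (hr : ∀ a b, IntervalIntegrable r volume a b) (a b : ℝ) :
    AbsolutelyContinuousOnInterval (fun x => ∫ s in a..x, r s) a b := by
  have hre : IntervalIntegrable (fun s => (r s).re) volume a b :=
    ⟨(hr a b).1.re, (hr a b).2.re⟩
  have him : IntervalIntegrable (fun s => (r s).im) volume a b :=
    ⟨(hr a b).1.im, (hr a b).2.im⟩
  have h1 := (hre.absolutelyContinuousOnInterval_intervalIntegral (c := a) (by simp)).fun_smul
    (contDiffOn_const (c := (1 : ℂ))).absolutelyContinuousOnInterval
  have h2 := (him.absolutelyContinuousOnInterval_intervalIntegral (c := a) (by simp)).fun_smul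
    (contDiffOn_const (c := Complex.I)).absolutelyContinuousOnInterval
  convert! h1.fun_add h2 using 2 with x
  have e1 := Complex.reCLM.intervalIntegral_comp_comm (hr a x)
  have e2 := Complex.imCLM.intervalIntegral_comp_comm (hr a x)
  simp only [Complex.reCLM_apply, Complex.imCLM_apply] at e1 e2
  rw [e1, e2, Complex.real_smul, Complex.real_smul, mul_one, Complex.re_add_im]

/-- Product rule, in integrated form, for a `C¹` function and an indefinite integral. -/
lemma mul_primitive_sub_eq_integral {φ φ' W r : ℝ → ℂ} (hφ : ∀ x, HasDerivAt φ (φ' x) x)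
    (hφ' : Continuous φ') (hr : ∀ a b, IntervalIntegrable r volume a b)
    (hW : ∀ x, W x = W 0 + ∫ s in (0:ℝ)..x, r s) (x : ℝ) :
    φ x * W x - φ 0 * W 0 = ∫ s in (0:ℝ)..x, (φ' s * W s + φ s * r s) := by
  have hφc : Continuous φ := continuous_iff_continuousAt.2 fun x => (hφ x).continuousAt
  have hWc : Continuous W := by
    rw [funext hW]
    exact continuous_const.add (intervalIntegral.continuous_primitive hr 0)
  have hint (a b : ℝ) : IntervalIntegrable (fun s => φ' s * W s + φ s * r s) volume a b :=
    ((hφ'.mul hWc).intervalIntegrable _ _).add ((hr a b).continuousOn_mul hφc.continuousOn)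
  have hφac : AbsolutelyContinuousOnInterval φ 0 x := by
    refine ContDiffOn.absolutelyContinuousOnInterval (ContDiff.contDiffOn ?_)
    rw [contDiff_one_iff_deriv]
    exact ⟨fun x => (hφ x).differentiableAt, by rwa [funext fun x => (hφ x).deriv]⟩
  have hWac : AbsolutelyContinuousOnInterval W 0 x := by
    rw [funext hW]
    exact (contDiffOn_const (c := W 0)).absolutelyContinuousOnInterval.fun_add
      (absolutelyContinuousOnInterval_primitive hr 0 x)
  have hD := (hφac.fun_smul hWac).fun_sub
    (absolutelyContinuousOnInterval_primitive hint 0 x)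
  obtain ⟨C, hC⟩ := hD.const_of_ae_hasDerivAt_zero (by
    filter_upwards [(hint 0 x).ae_hasDerivAt_integral, (hr 0 x).ae_hasDerivAt_integral] with z h1 h2 hz
    have hWz : HasDerivAt W (r z) z := by
      rw [funext hW]
      exact (h2 hz 0 (by simp)).const_add _
    convert! ((hφ z).smul hWz).sub (h1 hz 0 (by simp)) using 1
    simp only [smul_eq_mul]
    ring)
  have h0 := hC 0 (by simp)
  have hx := hC x (by simp)
  simp only [smul_eq_mul, intervalIntegral.integral_same] at h0 hx
  linear_combination hx - h0

end PrimitiveProduct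

section Coefficients

/-- The Fourier coefficients of a primitive of a function with mean zero. -/
lemma fCoeff_primitive {r : ℝ → ℂ} (hr : ∀ a b, IntervalIntegrable r volume a b)
    (h0 : ∫ s in (0:ℝ)..1, r s = 0) (k : ℤ) :
    2 * (Real.pi : ℂ) * Complex.I * k * fCoeff (fun x => ∫ s in (0:ℝ)..x, r s) k
      = fCoeff r k := by
  have hφ : ∀ x : ℝ, HasDerivAt
      (fun x : ℝ => Complex.exp (-(2 * (Real.pi : ℂ) * Complex.I * (k : ℂ) * (x : ℂ))))
      (-(2 * (Real.pi : ℂ) * Complex.I * (k : ℂ)) *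
        Complex.exp (-(2 * (Real.pi : ℂ) * Complex.I * (k : ℂ) * (x : ℂ)))) x := by
    intro x
    have := ((Complex.ofRealCLM.hasDerivAt (x := x)).const_mul
      (2 * (Real.pi : ℂ) * Complex.I * (k : ℂ))).neg.cexp
    convert! this using 1
    simp
    ring
  have hG : Continuous fun x => ∫ s in (0:ℝ)..x, r s :=
    intervalIntegral.continuous_primitive hr 0
  have hP := mul_primitive_sub_eq_integral (W := fun x => ∫ s in (0:ℝ)..x, r s) hφ
    (by fun_prop) hr (by simp) 1
  rw [intervalIntegral.integral_add (Continuous.intervalIntegrable (by fun_prop) _ _)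
    ((hr 0 1).continuousOn_mul (by fun_prop))] at hP
  simp only [h0, mul_zero, intervalIntegral.integral_same, sub_zero] at hP
  have e1 : ∫ x in (0:ℝ)..1, -(2 * (Real.pi : ℂ) * Complex.I * (k : ℂ)) *
        Complex.exp (-(2 * (Real.pi : ℂ) * Complex.I * (k : ℂ) * (x : ℂ))) *
        (∫ s in (0:ℝ)..x, r s) =
      -(2 * (Real.pi : ℂ) * Complex.I * (k : ℂ)) * fCoeff (fun x => ∫ s in (0:ℝ)..x, r s) k := by
    rw [fCoeff, ← intervalIntegral.integral_const_mul]
    congr 1 with x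
    ring
  have e2 : ∫ x in (0:ℝ)..1,
      Complex.exp (-(2 * (Real.pi : ℂ) * Complex.I * (k : ℂ) * (x : ℂ))) * r x = fCoeff r k := by
    rw [fCoeff]
    congr 1 with x
    ring
  rw [e1, e2] at hP
  linear_combination hP

lemma fCoeff_add {f g : ℝ → ℂ} (hf : IntervalIntegrable f volume 0 1)
    (hg : IntervalIntegrable g volume 0 1) (k : ℤ) :
    fCoeff (fun x => f x + g x) k = fCoeff f k + fCoeff g k := by
  simp only [fCoeff, add_mul]
  exact intervalIntegral.integral_add (hf.mul_continuousOn (by fun_prop))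
    (hg.mul_continuousOn (by fun_prop))

lemma fCoeff_const_mul (a : ℂ) (f : ℝ → ℂ) (k : ℤ) :
    fCoeff (fun x => a * f x) k = a * fCoeff f k := by
  simp only [fCoeff, mul_assoc, intervalIntegral.integral_const_mul]

lemma fCoeff_eq_fourierCoeff (f : UnitAddCircle → ℂ) (k : ℤ) :
    fCoeff (fun x => f x) k = fourierCoeff f k := by
  rw [fourierCoeff_eq_intervalIntegral f k 0, fCoeff]
  simp only [zero_add, div_one, one_smul, smul_eq_mul]
  congr 1 with x
  rw [fourier_coe_apply, mul_comm]
  congr 2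
  push_cast
  ring

lemma fCoeff_one (k : ℤ) : fCoeff (fun _ => 1) k = if k = 0 then 1 else 0 := by
  have h := fCoeff_eq_fourierCoeff (fun x => fourier 0 x) k
  rw [fourierCoeff_fourier] at h
  simpa [Pi.single_apply] using h

lemma fCoeff_norm_le (f : ℝ → ℂ) (k : ℤ) : ‖fCoeff f k‖ ≤ ∫ x in (0:ℝ)..1, ‖f x‖ := by
  refine (intervalIntegral.norm_integral_le_integral_norm zero_le_one).trans_eq ?_
  congr 1 with x
  rw [norm_mul, Complex.norm_exp]
  simp

/-- A continuous periodic function whose nonconstant Fourier modes vanish is constant. -/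
lemma eq_of_fCoeff_eq_zero {D : ℝ → ℂ} (hD : Continuous D) (hper : Function.Periodic D 1)
    (h0 : ∀ k : ℤ, k ≠ 0 → fCoeff D k = 0) (x : ℝ) : D x = D 0 := by
  let g : C(UnitAddCircle, ℂ) := ⟨hper.lift, continuous_coinduced_dom.2 hD⟩
  have hg : ∀ k : ℤ, k ≠ 0 → fourierCoeff g k = 0 := fun k hk => by
    rw [← fCoeff_eq_fourierCoeff, ← h0 k hk]
    rfl
  have hs : Summable (fourierCoeff g) :=
    summable_of_ne_finset_zero (s := {0}) fun k hk => hg k (by simpa using hk)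
  have key : ∀ z : ℝ, D z = fourierCoeff g 0 := fun z => by
    refine (has_pointwise_sum_fourier_series_of_summable hs (z : UnitAddCircle)).unique ?_
    have hsum := hasSum_single (f := fun k => fourierCoeff g k • fourier k (z : UnitAddCircle)) 0
      fun k hk => by simp [hg k hk]
    simpa only [fourier_zero, smul_eq_mul, mul_one] using hsum
  rw [key, key]

/-- Fourier coefficients of a product with an absolutely convergent one-sided series. -/
lemma hasSum_fCoeff_mul_s1 {r : ℝ → ℂ} (hr : IntervalIntegrable r volume 0 1) {c : ℕ → ℂ}
    (hc : Summable fun k => ‖c k‖) (m : ℤ) :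
    HasSum (fun k : ℕ => c k * fCoeff r (m - k))
      (fCoeff (fun x => r x *
        ∑' k : ℕ, c k * Complex.exp (2 * (Real.pi : ℂ) * Complex.I * (k : ℂ) * (x : ℂ))) m) := by
  have hn : ∀ (k : ℕ) (x : ℝ),
      ‖Complex.exp (2 * (Real.pi : ℂ) * Complex.I * (k : ℂ) * (x : ℂ))‖ = 1 := by
    intro k x
    rw [Complex.norm_exp]
    simp
  have hn' : ∀ (k : ℤ) (x : ℝ),
      ‖Complex.exp (-(2 * (Real.pi : ℂ) * Complex.I * (k : ℂ) * (x : ℂ)))‖ = 1 := by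
    intro k x
    rw [Complex.norm_exp]
    simp
  have hF : ∀ k : ℕ, IntervalIntegrable (fun x : ℝ => c k * (r x *
      Complex.exp (-(2 * (Real.pi : ℂ) * Complex.I * ((m - k : ℤ) : ℂ) * (x : ℂ))))) volume 0 1 :=
    fun k => (hr.mul_continuousOn (by fun_prop)).const_mul _
  have := intervalIntegral.hasSum_integral_of_dominated_convergence (μ := volume)
    (a := 0) (b := 1) (F := fun (k : ℕ) (x : ℝ) => c k * (r x *
      Complex.exp (-(2 * (Real.pi : ℂ) * Complex.I * ((m - k : ℤ) : ℂ) * (x : ℂ)))))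
    (f := fun x => r x *
        (∑' k : ℕ, c k * Complex.exp (2 * (Real.pi : ℂ) * Complex.I * (k : ℂ) * (x : ℂ))) *
        Complex.exp (-(2 * (Real.pi : ℂ) * Complex.I * (m : ℂ) * (x : ℂ))))
    (fun k x => ‖c k‖ * ‖r x‖)
    (fun k => (hF k).aestronglyMeasurable_restrict_uIoc)
    (fun k => Eventually.of_forall fun x _ => by rw [norm_mul, norm_mul, hn', mul_one])
    (Eventually.of_forall fun x _ => hc.mul_right _)
    (by simpa only [tsum_mul_right] using hr.norm.const_mul _)
    (Eventually.of_forall fun x _ => by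
      have hs : Summable fun k : ℕ =>
          c k * Complex.exp (2 * (Real.pi : ℂ) * Complex.I * (k : ℂ) * (x : ℂ)) :=
        Summable.of_norm (by simpa only [norm_mul, hn, mul_one] using hc)
      convert! (hs.hasSum.mul_left (r x)).mul_right
        (Complex.exp (-(2 * (Real.pi : ℂ) * Complex.I * (m : ℂ) * (x : ℂ)))) using 1
      ext k
      have : Complex.exp (-(2 * (Real.pi : ℂ) * Complex.I * ((m - k : ℤ) : ℂ) * (x : ℂ))) =
          Complex.exp (2 * (Real.pi : ℂ) * Complex.I * (k : ℂ) * (x : ℂ)) *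
          Complex.exp (-(2 * (Real.pi : ℂ) * Complex.I * (m : ℂ) * (x : ℂ))) := by
        rw [← Complex.exp_add]
        congr 1
        push_cast
        ring
      rw [this]
      ring)
  simp only [intervalIntegral.integral_const_mul] at this
  exact this

end Coefficients

section Recursion

/-- The coefficients of the Floquet solution `e^{iμx} ∑ cₖ e^{2πikx}` for a potential with
Fourier coefficients `a`. -/
def floquetCoeff (a : ℤ → ℂ) (μ : ℂ) : ℕ → ℂ
  | 0 => 1
  | k + 1 => -(∑ j : Fin (k + 1), floquetCoeff a μ j * a ((k + 1 : ℤ) - (j : ℕ))) /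
      (4 * (Real.pi : ℂ) * (k + 1 : ℂ) * (μ + (Real.pi : ℂ) * (k + 1 : ℂ)))
decreasing_by exact j.2

lemma floquetCoeff_succ (a : ℤ → ℂ) (μ : ℂ) (k : ℕ) :
    floquetCoeff a μ (k + 1) =
      -(∑ j ∈ Finset.range (k + 1), floquetCoeff a μ j * a ((k + 1 : ℤ) - (j : ℕ))) /
      (4 * (Real.pi : ℂ) * (k + 1 : ℂ) * (μ + (Real.pi : ℂ) * (k + 1 : ℂ))) := by
  rw [floquetCoeff, Finset.sum_range]

lemma exists_norm_div_le (μ : ℂ) :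
    ∃ B : ℝ, ∀ k : ℕ, ‖((k + 1 : ℂ)) / (μ + (Real.pi : ℂ) * (k + 1 : ℂ))‖ ≤ B := by
  have h1 : Tendsto (fun k : ℕ => (μ * ((k + 1 : ℂ))⁻¹ + (Real.pi : ℂ))⁻¹) atTop
      (nhds ((μ * 0 + (Real.pi : ℂ))⁻¹)) := by
    refine Tendsto.inv₀ ((Tendsto.const_mul _ ?_).add_const _) (by simp)
    simpa [one_div] using tendsto_one_div_add_atTop_nhds_zero_nat (𝕜 := ℂ)
  obtain ⟨B, hB⟩ := (Metric.isBounded_range_of_tendsto _ h1).exists_norm_le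
  refine ⟨B, fun k => ?_⟩
  convert! hB _ ⟨k, rfl⟩ using 2
  have hk : (k + 1 : ℂ) ≠ 0 := by exact_mod_cast k.succ_ne_zero
  rw [← inv_div]
  congr 1
  field_simp

lemma summable_of_norm_succ_le {c : ℕ → ℂ} {b : ℕ → ℝ} (hb : Summable b)
    (hb0 : ∀ k, 0 ≤ b k)
    (h : ∀ k, ‖c (k + 1)‖ ≤ b k * ∑ j ∈ Finset.range (k + 1), ‖c j‖) :
    Summable fun k => ‖c k‖ := by
  have key : ∀ k, ∑ j ∈ Finset.range (k + 1), ‖c j‖ ≤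
      ‖c 0‖ * Real.exp (∑ j ∈ Finset.range k, b j) := by
    intro k
    induction k with
    | zero => simp
    | succ k ih =>
      have h2 := Real.add_one_le_exp (b k)
      have hS : 0 ≤ ∑ j ∈ Finset.range (k + 1), ‖c j‖ := Finset.sum_nonneg fun _ _ => norm_nonneg _
      rw [Finset.sum_range_succ, Finset.sum_range_succ (fun j => b j), Real.exp_add]
      calc _ ≤ (∑ j ∈ Finset.range (k + 1), ‖c j‖) * (b k + 1) := by linarith [h k]
        _ ≤ (‖c 0‖ * Real.exp (∑ j ∈ Finset.range k, b j)) * Real.exp (b k) :=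
          mul_le_mul ih h2 (by linarith [hb0 k]) (by positivity)
        _ = _ := by ring
  refine summable_of_sum_range_le (c := ‖c 0‖ * Real.exp (∑' j, b j))
    (fun _ => norm_nonneg _) fun k => ?_
  calc _ ≤ ∑ j ∈ Finset.range (k + 1), ‖c j‖ :=
        Finset.sum_le_sum_of_subset_of_nonneg (Finset.range_mono k.le_succ)
          fun _ _ _ => norm_nonneg _
    _ ≤ _ := key k
    _ ≤ _ := by
      gcongr
      exact hb.sum_le_tsum _ fun j _ => hb0 j

lemma summable_norm_floquetCoeff {a : ℤ → ℂ} {M : ℝ} (ha : ∀ k, ‖a k‖ ≤ M) (μ : ℂ) :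
    Summable fun k => ‖floquetCoeff a μ k‖ := by
  obtain ⟨B, hB⟩ := exists_norm_div_le μ
  have hM : 0 ≤ M := (norm_nonneg _).trans (ha 0)
  have hB0 : 0 ≤ B := (norm_nonneg _).trans (hB 0)
  refine summable_of_norm_succ_le (b := fun k : ℕ => M * B * (1 / ((k : ℝ) + 1) ^ 2))
    (Summable.mul_left _ ?_) (fun k => by positivity) fun k => ?_
  · exact_mod_cast (summable_nat_add_iff 1).2 (Real.summable_one_div_nat_pow.2 one_lt_two)
  · have hk : (k + 1 : ℂ) ≠ 0 := by exact_mod_cast k.succ_ne_zero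
    have hkn : ‖(k + 1 : ℂ)‖ = (k : ℝ) + 1 := by
      exact_mod_cast Complex.norm_natCast (k + 1)
    have hS : ‖∑ j ∈ Finset.range (k + 1), floquetCoeff a μ j * a ((k + 1 : ℤ) - (j : ℕ))‖ ≤
        M * ∑ j ∈ Finset.range (k + 1), ‖floquetCoeff a μ j‖ := by
      rw [Finset.mul_sum]
      refine norm_sum_le_of_le _ fun j _ => ?_
      rw [norm_mul, mul_comm]
      gcongr
      exact ha _
    have hpi : ‖(4 * (Real.pi : ℂ))⁻¹‖ ≤ 1 := by
      rw [norm_inv]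
      refine inv_le_one_of_one_le₀ ?_
      simp [abs_of_pos Real.pi_pos]
      linarith [Real.pi_gt_three]
    have e : floquetCoeff a μ (k + 1) =
        (4 * (Real.pi : ℂ))⁻¹ * (-(∑ j ∈ Finset.range (k + 1),
          floquetCoeff a μ j * a ((k + 1 : ℤ) - (j : ℕ)))) *
          ((k + 1 : ℂ) / (μ + (Real.pi : ℂ) * (k + 1 : ℂ))) * (1 / (k + 1 : ℂ) ^ 2) := by
      rw [floquetCoeff_succ]
      simp only [div_eq_mul_inv, mul_inv]
      field_simp
    rw [e, norm_mul, norm_mul, norm_mul, norm_neg, norm_div 1, norm_pow, hkn, norm_one]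
    calc _ ≤ 1 * (M * ∑ j ∈ Finset.range (k + 1), ‖floquetCoeff a μ j‖) * B *
          (1 / ((k : ℝ) + 1) ^ 2) := by
          gcongr
          exact hB k
      _ = _ := by ring

end Recursion

lemma periodic_primitive {r : ℝ → ℂ} (hper : Function.Periodic r 1)
    (hr : ∀ a b, IntervalIntegrable r volume a b) (h0 : ∫ s in (0:ℝ)..1, r s = 0) :
    Function.Periodic (fun x => ∫ s in (0:ℝ)..x, r s) 1 := fun x => by
  have := hper.intervalIntegral_add_eq_add 0 x hr
  simpa [h0] using this

/-- A periodic profile whose Fourier coefficients satisfy the Hill recursion gives a solution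
of `-y'' + q y = μ² y` of the form `e^{iμx} f(x)`. -/
lemma isEigenfun_of_fCoeff {q f : ℝ → ℂ} (hqper : Function.Periodic q 1)
    (hq : ∀ a b, IntervalIntegrable q volume a b) (hf : Continuous f)
    (hfper : Function.Periodic f 1) (hf0 : ∃ x, f x ≠ 0) (μ : ℂ)
    (hcoeff : ∀ k : ℤ, fCoeff (fun x => q x * f x) k =
      -(4 * (Real.pi : ℂ) * k * (μ + (Real.pi : ℂ) * k)) * fCoeff f k) :
    IsEigenfun q μ (μ ^ 2) (fun x => Complex.exp (Complex.I * μ * x) * f x) := by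
  have hpi : (Real.pi : ℂ) ≠ 0 := by exact_mod_cast Real.pi_ne_zero
  set G : ℝ → ℂ := fun x => ∫ s in (0:ℝ)..x, q s * f s with hG
  have hqf : ∀ a b, IntervalIntegrable (fun x => q x * f x) volume a b :=
    fun a b => (hq a b).mul_continuousOn hf.continuousOn
  have hGc : Continuous G := intervalIntegral.continuous_primitive hqf 0
  have hmean : ∫ s in (0:ℝ)..1, q s * f s = 0 := by simpa [fCoeff] using hcoeff 0
  have hGper : Function.Periodic G 1 := periodic_primitive (hqper.mul hfper) hqf hmean
  obtain ⟨C, hC⟩ : ∃ C : ℂ, ∫ s in (0:ℝ)..1, (G s + (C * 1 + (-2 * Complex.I * μ) * f s)) = 0 := by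
    refine ⟨-∫ s in (0:ℝ)..1, (G s + (-2 * Complex.I * μ) * f s), ?_⟩
    have e : ∀ C : ℂ, (fun s => G s + (C * 1 + (-2 * Complex.I * μ) * f s)) =
        fun s => (G s + (-2 * Complex.I * μ) * f s) + C := fun C => by ext s; ring
    rw [e, intervalIntegral.integral_add (Continuous.intervalIntegrable (by fun_prop) _ _) (by simp)]
    simp
  set H : ℝ → ℂ := fun s => G s + (C * 1 + (-2 * Complex.I * μ) * f s) with hH
  have hHc : Continuous H := by fun_prop
  have hHper : Function.Periodic H 1 := fun x => by simp only [hH, hGper x, hfper x]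
  have hHi : ∀ a b, IntervalIntegrable H volume a b := fun a b => hHc.intervalIntegrable a b
  have hHcoeff : ∀ k : ℤ, k ≠ 0 → fCoeff H k = 2 * (Real.pi : ℂ) * Complex.I * k * fCoeff f k := by
    intro k hk
    have hk' : (k : ℂ) ≠ 0 := by exact_mod_cast hk
    have h1 := fCoeff_primitive hqf hmean k
    rw [hcoeff] at h1
    have h2 : fCoeff G k = 2 * Complex.I * (μ + (Real.pi : ℂ) * k) * fCoeff f k := by
      have hne : 2 * (Real.pi : ℂ) * Complex.I * k ≠ 0 := by simp [hpi, hk']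
      refine mul_left_cancel₀ hne (h1.trans ?_)
      linear_combination (-4 * (Real.pi : ℂ) * k * (μ + (Real.pi : ℂ) * k) * fCoeff f k) *
        Complex.I_sq
    rw [hH, fCoeff_add (hGc.intervalIntegrable _ _) (Continuous.intervalIntegrable (by fun_prop) _ _),
      fCoeff_add (Continuous.intervalIntegrable (by fun_prop) _ _)
        (Continuous.intervalIntegrable (by fun_prop) _ _),
      fCoeff_const_mul, fCoeff_const_mul, fCoeff_one, if_neg hk, h2]
    ring
  have hKc : Continuous fun x => ∫ s in (0:ℝ)..x, H s :=
    intervalIntegral.continuous_primitive hHi 0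
  have hfH : ∀ x, f x = f 0 + ∫ s in (0:ℝ)..x, H s := by
    intro x
    have := eq_of_fCoeff_eq_zero (D := fun x => f x + (-1) * ∫ s in (0:ℝ)..x, H s)
      (by fun_prop)
      (fun x => by
        have := periodic_primitive hHper hHi hC x
        simp only at this
        simp only [this, hfper x])
      (fun k hk => by
        have hk' : (k : ℂ) ≠ 0 := by exact_mod_cast hk
        have hne : 2 * (Real.pi : ℂ) * Complex.I * k ≠ 0 := by simp [hpi, hk']
        have h1 := fCoeff_primitive hHi hC k
        rw [hHcoeff k hk] at h1
        rw [fCoeff_add (hf.intervalIntegrable _ _)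
          (Continuous.intervalIntegrable (by fun_prop) _ _), fCoeff_const_mul,
          mul_left_cancel₀ hne h1]
        ring) x
    simp only [intervalIntegral.integral_same] at this
    linear_combination this
  have hfd : ∀ x, HasDerivAt f (H x) x := by
    intro x
    rw [funext hfH]
    exact (intervalIntegral.integral_hasDerivAt_right (hHi _ _)
      hHc.aestronglyMeasurable.stronglyMeasurableAtFilter hHc.continuousAt).const_add _
  have hφ : ∀ x : ℝ, HasDerivAt (fun x : ℝ => Complex.exp (Complex.I * μ * x))
      (Complex.I * μ * Complex.exp (Complex.I * μ * x)) x := by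
    intro x
    have := ((Complex.ofRealCLM.hasDerivAt (x := x)).const_mul (Complex.I * μ)).cexp
    convert! this using 1
    simp
    ring
  set W : ℝ → ℂ := fun x => G x + C - Complex.I * μ * f x with hW
  have hyd : ∀ x : ℝ, HasDerivAt (fun x : ℝ => Complex.exp (Complex.I * μ * x) * f x)
      (Complex.exp (Complex.I * μ * x) * W x) x := by
    intro x
    convert! (hφ x).mul (hfd x) using 1
    simp only [hW, hH]
    ring
  have hyd' := fun x => (hyd x).deriv
  have hWr : ∀ x, W x = W 0 + ∫ s in (0:ℝ)..x, (q s * f s + (-(Complex.I * μ)) * H s) := by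
    intro x
    rw [intervalIntegral.integral_add (hqf _ _) ((hHi _ _).const_mul _),
      intervalIntegral.integral_const_mul]
    simp only [hW, hG, intervalIntegral.integral_same]
    linear_combination (-(Complex.I * μ)) * hfH x
  refine ⟨⟨fun x => (hyd x).differentiableAt, fun x => ?_⟩, ?_, ?_, ?_⟩
  · rw [hyd', hyd', ← sub_eq_iff_eq_add', mul_primitive_sub_eq_integral hφ (by fun_prop)
      (fun a b => (hqf a b).add ((hHi a b).const_mul _)) hWr x]
    congr 1 with s
    simp only [hW, hH]
    linear_combination (Complex.exp (Complex.I * μ * s) * μ ^ 2 * f s) * Complex.I_sq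
  · obtain ⟨x, hx⟩ := hf0
    exact ⟨x, mul_ne_zero (Complex.exp_ne_zero _) hx⟩
  · have := hfper 0
    rw [zero_add] at this
    simp [this]
  · have h1 := hfper 0
    have h2 := hGper 0
    rw [zero_add] at h1 h2
    rw [hyd', hyd']
    simp [hW, h1, h2]

lemma exists_isEigenfun_of_nonresonant {q : ℝ → ℂ} (hq : MemL1Plus q) {μ : ℂ}
    (hμ : ∀ k : ℕ, μ + (Real.pi : ℂ) * (k + 1 : ℂ) ≠ 0) :
    ∃ y : ℝ → ℂ, IsEigenfun q μ (μ ^ 2) y := by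
  obtain ⟨hper, hint, hneg⟩ := hq
  set c := floquetCoeff (fCoeff q) μ with hc
  have hs : Summable fun k => ‖c k‖ := summable_norm_floquetCoeff (fCoeff_norm_le q) μ
  set f : ℝ → ℂ := fun x =>
    ∑' k : ℕ, c k * Complex.exp (2 * (Real.pi : ℂ) * Complex.I * (k : ℂ) * (x : ℂ)) with hf
  have hfc : Continuous f := by
    refine continuous_tsum (fun k => by fun_prop) hs fun k x => ?_
    rw [norm_mul, Complex.norm_exp]
    simp
  have hfper : Function.Periodic f 1 := fun x => by
    simp only [hf]
    congr 1 with k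
    congr 1
    rw [Complex.exp_eq_exp_iff_exists_int]
    exact ⟨k, by push_cast; ring⟩
  have hfcoeff : ∀ m : ℤ, HasSum (fun k : ℕ => c k * if m - k = 0 then 1 else 0) (fCoeff f m) := by
    intro m
    have := hasSum_fCoeff_mul_s1 (r := fun _ => 1) (by simp) hs m
    simpa only [fCoeff_one, one_mul] using this
  have hfnat : ∀ m : ℕ, fCoeff f m = c m := fun m => by
    refine (hfcoeff m).unique ?_
    have hsum := hasSum_single (f := fun k : ℕ => c k * if (m : ℤ) - k = 0 then 1 else 0) m
      fun k hk => by rw [if_neg (by omega), mul_zero]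
    simpa only [sub_self, if_true, mul_one] using hsum
  have hfneg : ∀ m : ℤ, m < 0 → fCoeff f m = 0 := fun m hm => by
    refine (hfcoeff m).unique ?_
    convert! hasSum_zero using 2 with k
    rw [if_neg (by omega), mul_zero]
  refine ⟨_, isEigenfun_of_fCoeff hper
    (Function.Periodic.intervalIntegrable₀ hper one_ne_zero hint) hfc hfper ?_ μ fun m => ?_⟩
  · by_contra! h
    have h0 := hfnat 0
    rw [funext h] at h0
    simp [hc, floquetCoeff, fCoeff] at h0
  · have hsum := hasSum_fCoeff_mul_s1 hint hs m
    rcases lt_or_ge 0 m with hm | hm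
    · obtain ⟨p, rfl⟩ : ∃ p : ℕ, m = ((p + 1 : ℕ) : ℤ) := ⟨(m - 1).toNat, by omega⟩
      rw [hfnat]
      have h1 := hsum.unique (hasSum_sum_of_ne_finset_zero (s := Finset.range (p + 1))
        fun k hk => by
          rw [Finset.mem_range, not_lt] at hk
          rw [hneg _ (by omega), mul_zero])
      have hp : (p + 1 : ℂ) ≠ 0 := by exact_mod_cast p.succ_ne_zero
      have hμp := hμ p
      rw [h1, hc, floquetCoeff_succ]
      push_cast
      field_simp
    · rw [hsum.unique (by
        convert! hasSum_zero using 2 with k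
        rw [hneg _ (by omega), mul_zero])]
      rcases hm.lt_or_eq with hm | rfl
      · rw [hfneg m hm, mul_zero]
      · simp

/-- For `q ∈ L¹₊` and any `t ∈ ℂ`, `n ∈ ℤ`, the number `(2πn + t)²` is an eigenvalue
of `L_t(q)`. -/
theorem eigenvalue_exists (q : ℝ → ℂ) (hq : MemL1Plus q) (t : ℂ) (n : ℤ) :
    ∃ y : ℝ → ℂ, IsEigenfun q t ((2 * (Real.pi : ℂ) * (n : ℂ) + t) ^ 2) y := by
  have key : ∀ μ : ℂ, (∀ k : ℕ, μ + (Real.pi : ℂ) * (k + 1 : ℂ) ≠ 0) →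
      Complex.exp (Complex.I * μ) = Complex.exp (Complex.I * t) →
      μ ^ 2 = (2 * (Real.pi : ℂ) * (n : ℂ) + t) ^ 2 →
      ∃ y : ℝ → ℂ, IsEigenfun q t ((2 * (Real.pi : ℂ) * (n : ℂ) + t) ^ 2) y := by
    intro μ hμ hexp hsq
    obtain ⟨y, hy⟩ := exists_isEigenfun_of_nonresonant hq hμ
    rw [IsEigenfun, hexp, hsq] at hy
    exact ⟨y, hy⟩
  by_cases h : ∀ k : ℕ, 2 * (Real.pi : ℂ) * (n : ℂ) + t + (Real.pi : ℂ) * (k + 1 : ℂ) ≠ 0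
  · refine key _ h ?_ rfl
    rw [Complex.exp_eq_exp_iff_exists_int]
    exact ⟨n, by ring⟩
  · push Not at h
    obtain ⟨k, hk⟩ := h
    have ht : t = -(2 * (Real.pi : ℂ) * n) - Real.pi * (k + 1) := by linear_combination hk
    refine key ((Real.pi : ℂ) * (k + 1 : ℂ)) (fun j => ?_) ?_ ?_
    · rw [← mul_add]
      refine mul_ne_zero (by exact_mod_cast Real.pi_ne_zero) ?_
      exact_mod_cast (show k + 1 + (j + 1) ≠ 0 by omega)
    · rw [Complex.exp_eq_exp_iff_exists_int]
      refine ⟨k + 1 + n, ?_⟩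
      rw [ht]
      push_cast
      ring
    · rw [ht]
      ring

end
end

section
/- Let q : ℝ → ℂ be 1-periodic, integrable on [0,1], with Fourier coefficients q_n = ∫₀¹ q(x)e^{-2πinx}dx satisfying q_n = 0 for all integers n ≤ 0, and let t ∈ ℂ with t ≠ πk for every integer k. Then for each integer n the eigenvalue (2πn+t)² of L_t(q) is geometrically simple: any two eigenfunctions y₁, y₂ of L_t(q) corresponding to the eigenvalue (2πn+t)² are linearly dependent, i.e. there exist (a,b) ∈ ℂ² with (a,b) ≠ (0,0) and a·y₁(x) + b·y₂(x) = 0 for all x. -/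
open MeasureTheory Filter

noncomputable section

open Set Topology

theorem absolutelyContinuousOnInterval_intervalIntegral_complex
    {f : ℝ → ℂ} (hf : ∀ x y, IntervalIntegrable f volume x y) (a b : ℝ) :
    AbsolutelyContinuousOnInterval (fun x ↦ ∫ s in a..x, f s) a b := by
  have hre : ∀ x y, IntervalIntegrable (fun s ↦ (f s).re) volume x y := fun x y ↦
    ⟨(hf x y).1.re, (hf x y).2.re⟩
  have him : ∀ x y, IntervalIntegrable (fun s ↦ (f s).im) volume x y := fun x y ↦
    ⟨(hf x y).1.im, (hf x y).2.im⟩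
  have hconst (w : ℂ) : AbsolutelyContinuousOnInterval (fun _ : ℝ ↦ w) a b :=
    contDiffOn_const.absolutelyContinuousOnInterval
  have h := (((hre a b).absolutelyContinuousOnInterval_intervalIntegral
    (c := a) left_mem_uIcc).fun_smul (hconst 1)).fun_add
    (((him a b).absolutelyContinuousOnInterval_intervalIntegral
    (c := a) left_mem_uIcc).fun_smul (hconst Complex.I))
  convert! h using 1
  funext x
  have hx : ∀ s, f s = ((f s).re : ℂ) + ((f s).im : ℂ) * Complex.I := fun s ↦
    (Complex.re_add_im _).symm
  rw [intervalIntegral.integral_congr (fun s _ ↦ hx s), intervalIntegral.integral_add,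
    intervalIntegral.integral_mul_const, intervalIntegral.integral_ofReal,
    intervalIntegral.integral_ofReal]
  · simp
  · exact ⟨(hre a x).1.ofReal, (hre a x).2.ofReal⟩
  · exact IntervalIntegrable.mul_const ⟨(him a x).1.ofReal, (him a x).2.ofReal⟩ _

namespace IsCaraSol

variable {q : ℝ → ℂ} {lam : ℂ} {y z : ℝ → ℂ}

theorem intervalIntegrable_potential_mul (hy : IsCaraSol q lam y)
    (hq : ∀ a b, IntervalIntegrable q volume a b) (a b : ℝ) :
    IntervalIntegrable (fun s ↦ (q s - lam) * y s) volume a b :=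
  ((hq a b).sub intervalIntegrable_const).mul_continuousOn hy.1.continuous.continuousOn

theorem continuous_deriv (hy : IsCaraSol q lam y)
    (hq : ∀ a b, IntervalIntegrable q volume a b) : Continuous (deriv y) := by
  rw [funext hy.2]
  exact continuous_const.add
    (intervalIntegral.continuous_primitive (hy.intervalIntegrable_potential_mul hq) 0)

theorem absolutelyContinuousOnInterval (hy : IsCaraSol q lam y)
    (hq : ∀ a b, IntervalIntegrable q volume a b) (b : ℝ) :
    AbsolutelyContinuousOnInterval y 0 b :=
  (contDiff_one_iff_deriv.2
    ⟨hy.1, hy.continuous_deriv hq⟩).contDiffOn.absolutelyContinuousOnInterval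

theorem absolutelyContinuousOnInterval_deriv (hy : IsCaraSol q lam y)
    (hq : ∀ a b, IntervalIntegrable q volume a b) (b : ℝ) :
    AbsolutelyContinuousOnInterval (deriv y) 0 b := by
  rw [funext hy.2]
  exact contDiffOn_const.absolutelyContinuousOnInterval.fun_add
    (absolutelyContinuousOnInterval_intervalIntegral_complex
      (hy.intervalIntegrable_potential_mul hq) 0 b)

theorem ae_hasDerivAt_deriv (hy : IsCaraSol q lam y)
    (hq : ∀ a b, IntervalIntegrable q volume a b) (b : ℝ) :
    ∀ᵐ x, x ∈ uIcc 0 b → HasDerivAt (deriv y) ((q x - lam) * y x) x := by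
  filter_upwards [(hy.intervalIntegrable_potential_mul hq 0 b).ae_hasDerivAt_integral] with x hx hxb
  rw [funext hy.2]
  exact (hx hxb 0 left_mem_uIcc).const_add _

/-- The Wronskian of two solutions is constant. -/
theorem wronskian_eq (hy : IsCaraSol q lam y) (hz : IsCaraSol q lam z)
    (hq : ∀ a b, IntervalIntegrable q volume a b) (b : ℝ) :
    y b * deriv z b - z b * deriv y b = y 0 * deriv z 0 - z 0 * deriv y 0 := by
  have hac : AbsolutelyContinuousOnInterval (fun x ↦ y x * deriv z x - z x * deriv y x) 0 b :=
    ((hy.absolutelyContinuousOnInterval hq b).fun_smul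
      (hz.absolutelyContinuousOnInterval_deriv hq b)).fun_sub
    ((hz.absolutelyContinuousOnInterval hq b).fun_smul
      (hy.absolutelyContinuousOnInterval_deriv hq b))
  obtain ⟨C, hC⟩ := hac.const_of_ae_hasDerivAt_zero (by
    filter_upwards [hy.ae_hasDerivAt_deriv hq b, hz.ae_hasDerivAt_deriv hq b] with x hyx hzx hx
    convert! ((hy.1 x).hasDerivAt.mul (hzx hx)).sub ((hz.1 x).hasDerivAt.mul (hyx hx)) using 1
    ring)
  exact (hC b right_mem_uIcc).trans (hC 0 left_mem_uIcc).symm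

theorem const_mul_add_const_mul (hy : IsCaraSol q lam y) (hz : IsCaraSol q lam z)
    (hq : ∀ a b, IntervalIntegrable q volume a b) (a b : ℂ) :
    IsCaraSol q lam (fun x ↦ a * y x + b * z x) := by
  have hd (x : ℝ) : deriv (fun x ↦ a * y x + b * z x) x = a * deriv y x + b * deriv z x :=
    (((hy.1 x).hasDerivAt.const_mul a).add ((hz.1 x).hasDerivAt.const_mul b)).deriv
  refine ⟨(hy.1.const_mul a).add (hz.1.const_mul b), fun x ↦ ?_⟩
  have hint : ∫ s in (0:ℝ)..x, (q s - lam) * (a * y s + b * z s) =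
      a * (∫ s in (0:ℝ)..x, (q s - lam) * y s) + b * ∫ s in (0:ℝ)..x, (q s - lam) * z s := by
    rw [← intervalIntegral.integral_const_mul, ← intervalIntegral.integral_const_mul,
      ← intervalIntegral.integral_add ((hy.intervalIntegrable_potential_mul hq 0 x).const_mul a)
        ((hz.intervalIntegrable_potential_mul hq 0 x).const_mul b)]
    congr 1 with s
    ring
  rw [hd, hd, hint, hy.2 x, hz.2 x]
  ring

theorem eventually_zero_of_zero (hz : IsCaraSol q lam z)
    (hq : ∀ a b, IntervalIntegrable q volume a b) {c : ℝ} (hc : z c = 0) (hc' : deriv z c = 0) :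
    ∀ᶠ x in 𝓝 c, z x = 0 ∧ deriv z x = 0 := by
  have hk : ∀ a b, IntervalIntegrable (fun s ↦ ‖q s - lam‖ + 1) volume a b := fun a b ↦
    ((hq a b).sub intervalIntegrable_const).norm.add intervalIntegrable_const
  have hK := (intervalIntegral.continuous_primitive hk c).abs.tendsto c
  rw [intervalIntegral.integral_same, abs_zero] at hK
  obtain ⟨δ, hδ, hball⟩ := Metric.nhds_basis_closedBall.eventually_iff.1
    (hK.eventually_le_const (by norm_num : (0 : ℝ) < 1 / 2))
  have hdc := hz.continuous_deriv hq
  obtain ⟨m, hm, hmax⟩ := (isCompact_closedBall c δ).exists_isMaxOn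
    (Metric.nonempty_closedBall.2 hδ.le)
    (hz.1.continuous.prodMk hdc).norm.continuousOn
  set M := ‖(z m, deriv z m)‖
  have hle : ∀ x ∈ Metric.closedBall c δ, ‖z x‖ ≤ M ∧ ‖deriv z x‖ ≤ M := fun x hx ↦
    norm_prod_le_iff.1 (hmax hx)
  have hbound : ∀ f : ℝ → ℂ, (∀ s ∈ Metric.closedBall c δ, ‖f s‖ ≤ (‖q s - lam‖ + 1) * M) →
      ‖∫ s in c..m, f s‖ ≤ M / 2 := by
    intro f hf
    have h := intervalIntegral.norm_integral_le_abs_of_norm_le (μ := volume) (a := c) (b := m)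
      (ae_restrict_of_forall_mem measurableSet_uIoc fun s hs ↦ hf s ?_) ((hk c m).mul_const M)
    · rw [intervalIntegral.integral_mul_const, abs_mul, abs_of_nonneg (norm_nonneg _ : 0 ≤ M)] at h
      nlinarith [hball hm, (norm_nonneg _ : 0 ≤ M)]
    · exact (convex_closedBall c δ).ordConnected.uIcc_subset (Metric.mem_closedBall_self hδ.le) hm
        (uIoc_subset_uIcc hs)
  have hzm : z m = ∫ s in c..m, deriv z s := by
    rw [intervalIntegral.integral_deriv_eq_sub (fun x _ ↦ hz.1 x) (hdc.intervalIntegrable _ _), hc,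
      sub_zero]
  have hdm : deriv z m = ∫ s in c..m, (q s - lam) * z s := by
    rw [← intervalIntegral.integral_interval_sub_left (a := 0)
      (hz.intervalIntegrable_potential_mul hq _ _) (hz.intervalIntegrable_potential_mul hq _ _)]
    linear_combination hz.2 m - hz.2 c + hc'
  have hM0 : M ≤ M / 2 := by
    refine norm_prod_le_iff.2 ⟨?_, ?_⟩
    · dsimp only
      rw [hzm]
      refine hbound _ fun s hs ↦ (hle s hs).2.trans ?_
      nlinarith [norm_nonneg (q s - lam), (norm_nonneg _ : 0 ≤ M)]
    · dsimp only
      rw [hdm]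
      refine hbound _ fun s hs ↦ ?_
      rw [norm_mul]
      nlinarith [norm_nonneg (q s - lam), (norm_nonneg _ : 0 ≤ M), (hle s hs).1]
  filter_upwards [Metric.closedBall_mem_nhds c hδ] with x hx
  obtain ⟨h1, h2⟩ := hle x hx
  exact ⟨norm_le_zero_iff.1 (by linarith), norm_le_zero_iff.1 (by linarith)⟩

/-- A solution with zero initial data vanishes identically. -/
theorem eq_zero_of_initial (hz : IsCaraSol q lam z)
    (hq : ∀ a b, IntervalIntegrable q volume a b) (h0 : z 0 = 0) (h0' : deriv z 0 = 0) (x : ℝ) :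
    z x = 0 := by
  have hclopen : IsClopen {x | z x = 0 ∧ deriv z x = 0} :=
    ⟨(isClosed_eq hz.1.continuous continuous_const).inter
      (isClosed_eq (hz.continuous_deriv hq) continuous_const),
      isOpen_iff_mem_nhds.2 fun c hc ↦ hz.eventually_zero_of_zero hq hc.1 hc.2⟩
  have huniv := hclopen.eq_univ ⟨0, h0, h0'⟩
  exact (huniv.symm ▸ mem_univ x : x ∈ {x | z x = 0 ∧ deriv z x = 0}).1

end IsCaraSol

/-- For `q ∈ L¹₊` and `t ≠ πk` for all `k ∈ ℤ`, each eigenvalue `(2πn + t)²` of `L_t(q)`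
is geometrically simple: any two eigenfunctions are linearly dependent. -/
theorem eigenvalue_simple (q : ℝ → ℂ) (hq : MemL1Plus q) (t : ℂ)
    (ht : ∀ k : ℤ, t ≠ (Real.pi : ℂ) * (k : ℂ)) (n : ℤ) (y₁ y₂ : ℝ → ℂ)
    (h₁ : IsEigenfun q t ((2 * (Real.pi : ℂ) * (n : ℂ) + t) ^ 2) y₁)
    (h₂ : IsEigenfun q t ((2 * (Real.pi : ℂ) * (n : ℂ) + t) ^ 2) y₂) :
    ∃ a b : ℂ, (a, b) ≠ ((0 : ℂ), (0 : ℂ)) ∧ ∀ x : ℝ, a * y₁ x + b * y₂ x = 0 := by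
  have hint : ∀ a b, IntervalIntegrable q volume a b :=
    Function.Periodic.intervalIntegrable₀ hq.1 one_ne_zero hq.2.1
  obtain ⟨hs₁, -, hb₁, hb₁'⟩ := h₁
  obtain ⟨hs₂, -, hb₂, hb₂'⟩ := h₂
  have hexp : Complex.exp (Complex.I * t) * Complex.exp (Complex.I * t) - 1 ≠ 0 := by
    rw [← Complex.exp_add, sub_ne_zero, Ne, Complex.exp_eq_one_iff]
    rintro ⟨k, hk⟩
    apply ht k
    apply mul_left_cancel₀ (mul_ne_zero two_ne_zero Complex.I_ne_zero)
    linear_combination hk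
  have hW : y₁ 0 * deriv y₂ 0 - y₂ 0 * deriv y₁ 0 = 0 := by
    have h := hs₁.wronskian_eq hs₂ hint 1
    rw [hb₁, hb₂, hb₁', hb₂'] at h
    refine (mul_eq_zero.1 ?_).resolve_left hexp
    linear_combination h
  have key (a b : ℂ) (hab : (a, b) ≠ ((0 : ℂ), (0 : ℂ))) (h0 : a * y₁ 0 + b * y₂ 0 = 0)
      (h0' : a * deriv y₁ 0 + b * deriv y₂ 0 = 0) :
      ∃ a b : ℂ, (a, b) ≠ ((0 : ℂ), (0 : ℂ)) ∧ ∀ x : ℝ, a * y₁ x + b * y₂ x = 0 := by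
    refine ⟨a, b, hab, (hs₁.const_mul_add_const_mul hs₂ hint a b).eq_zero_of_initial hint h0 ?_⟩
    rw [← h0']
    exact (((hs₁.1 0).hasDerivAt.const_mul a).add ((hs₂.1 0).hasDerivAt.const_mul b)).deriv
  by_cases h : (y₂ 0, -y₁ 0) = ((0 : ℂ), (0 : ℂ))
  · by_cases h' : (deriv y₂ 0, -deriv y₁ 0) = ((0 : ℂ), (0 : ℂ))
    · simp only [Prod.mk.injEq, neg_eq_zero] at h h'
      exact key 1 0 (by simp) (by simp [h.2]) (by simp [h'.2])
    · exact key _ _ h' (by linear_combination hW) (by ring)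
  · exact key _ _ h (by ring) (by linear_combination -hW)

end
end
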